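/- Let A, g be positive integers, χ a Dirichlet character modulo g, and α a real number. Suppose there exist integers a and q ≥ 1 with gcd(a, q) = 1 and |α − a/q| ≤ 1/q². Then there is a constant C (depending only on A and g) such that for all x ≥ 2, |∑_{p ≤ x} χ(p)(log p)·e(αAp)| ≤ C·(x^{4/5} + x·q^{−1/2} + x^{1/2}·q^{1/2})·(log x)³, where the sum is over primes p ≤ x and e(θ) = e^{2πiθ}. -/

import Mathlib

attribute [local instance] Classical.propDecidable

/-- `e θ = e^{2πiθ}`. -/
noncomputable def e (θ : ℝ) : ℂ := Complex.exp (2 * Real.pi * Complex.I * θ)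

/-- The distance from `θ` to the nearest integer. -/
noncomputable def distInt (θ : ℝ) : ℝ := |θ - round θ|

/-- `min (Y, 1 / ‖θ‖)`, with the value `Y` when `θ` is an integer. -/
noncomputable def cappedInv (Y θ : ℝ) : ℝ :=
  if distInt θ = 0 then Y else min Y (1 / distInt θ)

lemma distInt_nonneg (θ : ℝ) : 0 ≤ distInt θ := abs_nonneg _

lemma cappedInv_le (Y θ : ℝ) : cappedInv Y θ ≤ Y := by
  unfold cappedInv
  split_ifs
  · exact le_rfl
  · exact min_le_left _ _

lemma cappedInv_mul_distInt_le (Y θ : ℝ) : cappedInv Y θ * distInt θ ≤ 1 := by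
  unfold cappedInv
  split_ifs with h
  · simp [h]
  · have h' : 0 < distInt θ := lt_of_le_of_ne (distInt_nonneg θ) (Ne.symm h)
    rw [← le_div_iff₀ h']
    exact min_le_right _ _

lemma le_cappedInv {t Y θ : ℝ} (h₁ : t ≤ Y) (h₂ : t * distInt θ ≤ 1) : t ≤ cappedInv Y θ := by
  unfold cappedInv
  split_ifs with h
  · exact h₁
  · have h' : 0 < distInt θ := lt_of_le_of_ne (distInt_nonneg θ) (Ne.symm h)
    exact le_min h₁ ((le_div_iff₀ h').2 h₂)

lemma cappedInv_nonneg {Y : ℝ} (hY : 0 ≤ Y) (θ : ℝ) : 0 ≤ cappedInv Y θ :=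
  le_cappedInv hY (by simp)

lemma e_add (x y : ℝ) : e (x + y) = e x * e y := by
  simp only [e]
  rw [← Complex.exp_add]
  push_cast
  ring_nf

lemma norm_e (x : ℝ) : ‖e x‖ = 1 := by
  have : (2 * Real.pi * Complex.I * x : ℂ) = ((2 * Real.pi * x : ℝ) : ℂ) * Complex.I := by
    push_cast; ring
  rw [e, this, Complex.norm_exp_ofReal_mul_I]

lemma e_intCast (n : ℤ) : e n = 1 := by
  rw [e, Complex.exp_eq_one_iff]
  exact ⟨n, by push_cast; ring⟩

lemma four_mul_distInt_le (φ : ℝ) : 4 * distInt φ ≤ ‖e φ - 1‖ := by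
  have h1 : e φ = e (φ - round φ) := by
    have := e_add (φ - round φ) (round φ : ℤ)
    rw [e_intCast, mul_one, sub_add_cancel] at this
    exact this
  have hle : |φ - round φ| ≤ 1 / 2 := abs_sub_round φ
  set t : ℝ := φ - round φ with ht
  have h2 : ‖e t - 1‖ = 2 * |Real.sin (Real.pi * t)| := by
    have := Complex.norm_exp_I_mul_ofReal_sub_one (2 * Real.pi * t)
    rw [e, show (2 * Real.pi * Complex.I * t : ℂ) = Complex.I * ((2 * Real.pi * t : ℝ) : ℂ) by
      push_cast; ring, this, show 2 * Real.pi * t / 2 = Real.pi * t by ring, norm_mul]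
    simp
  have h3 := Real.mul_abs_le_abs_sin (x := Real.pi * t) (by
    rw [abs_mul, abs_of_pos Real.pi_pos]
    nlinarith [Real.pi_pos])
  rw [abs_mul, abs_of_pos Real.pi_pos, ← mul_assoc, div_mul_cancel₀ _ Real.pi_ne_zero] at h3
  rw [h1, h2, distInt, ← ht]
  linarith

/-- A sum of `c m * e (θ m)` over an interval, with `c` of period `g`, satisfies the bound
of a geometric series of ratio `e (g θ)`. -/
lemma norm_sum_periodic_mul_distInt_le {g : ℕ} {c : ℕ → ℂ} (hc : ∀ m, c (m + g) = c m)
    (hc1 : ∀ m, ‖c m‖ ≤ 1) (θ : ℝ) {a b : ℕ} (hab : a ≤ b) :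
    ‖∑ m ∈ Finset.Ico a b, c m * e (θ * m)‖ * distInt (θ * g) ≤ g := by
  set F : ℕ → ℂ := fun m => c m * e (θ * m) with hF
  have hF1 : ∀ m, ‖F m‖ ≤ 1 := fun m => by
    simp only [hF, norm_mul, norm_e, mul_one]; exact hc1 m
  have hshift : ∀ m, F (m + g) = F m * e (θ * g) := fun m => by
    simp only [hF, hc, Nat.cast_add, mul_add, e_add]; ring
  have hlen : ∀ n, ‖∑ m ∈ Finset.Ico n (n + g), F m‖ ≤ g := fun n => by
    refine (norm_sum_le_of_le _ (fun m _ => hF1 m)).trans ?_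
    simp
  have h1 : (∑ m ∈ Finset.Ico a b, F m) * (e (θ * g) - 1)
      = ∑ m ∈ Finset.Ico b (b + g), F m - ∑ m ∈ Finset.Ico a (a + g), F m := by
    have h2 : (∑ m ∈ Finset.Ico a b, F m) * e (θ * g) = ∑ m ∈ Finset.Ico (a + g) (b + g), F m := by
      rw [Finset.sum_mul, ← Finset.sum_Ico_add']
      exact Finset.sum_congr rfl fun m _ => (hshift m).symm
    have h3 := Finset.sum_Ico_consecutive F hab (Nat.le_add_right b g)
    have h4 := Finset.sum_Ico_consecutive F (Nat.le_add_right a g) (Nat.add_le_add_right hab g)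
    rw [mul_sub, h2, mul_one]
    linear_combination h4 - h3
  have h5 : ‖∑ m ∈ Finset.Ico a b, F m‖ * ‖e (θ * g) - 1‖ ≤ g + g := by
    rw [← norm_mul, h1]
    exact (norm_sub_le _ _).trans (add_le_add (hlen b) (hlen a))
  nlinarith [four_mul_distInt_le (θ * g), norm_nonneg (∑ m ∈ Finset.Ico a b, F m),
    mul_le_mul_of_nonneg_left (four_mul_distInt_le (θ * g))
      (norm_nonneg (∑ m ∈ Finset.Ico a b, F m)), distInt_nonneg (θ * g),
      (Nat.cast_nonneg g : (0:ℝ) ≤ g)]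

lemma sum_one_div_range_le (n : ℕ) : ∑ s ∈ Finset.range n, 1 / ((s : ℝ) + 1) ≤ 1 + Real.log n := by
  have h := harmonic_le_one_add_log n
  have h2 : ((harmonic n : ℚ) : ℝ) = ∑ s ∈ Finset.range n, 1 / ((s : ℝ) + 1) := by
    simp [harmonic]
  rwa [h2] at h

lemma distInt_lower_of_approx {q : ℕ} (hq : 1 ≤ q) {θ δ : ℝ} {s : ℕ} {t : ℤ}
    (h : |θ - (((s : ℝ) + q * t) / q)| ≤ δ / q) :
    (s - δ) / q ≤ distInt θ ∨ (q - s - δ) / q ≤ distInt θ := by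
  have hq0 : (0 : ℝ) < q := by exact_mod_cast hq
  have h1 : ((s : ℝ) + q * t) / q = s / q + t := by field_simp
  rw [h1, abs_le] at h
  obtain ⟨hl, hu⟩ := h
  unfold distInt
  rcases le_or_gt (round θ) t with hz | hz
  · left
    have hz' : (round θ : ℝ) ≤ t := by exact_mod_cast hz
    refine le_trans ?_ (le_abs_self _)
    rw [sub_div]
    linarith
  · right
    have hz' : (t : ℝ) + 1 ≤ round θ := by exact_mod_cast hz
    refine le_trans ?_ (neg_le_abs _)
    rw [sub_div, sub_div, div_self hq0.ne']
    linarith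

lemma sum_block_le {α : ℝ} {a : ℤ} {q : ℕ} (hq : 1 ≤ q) (hco : Int.gcd a q = 1)
    (hα : |α - (a : ℝ) / q| ≤ 1 / (q : ℝ) ^ 2) (η : ℝ) {Y : ℝ} (hY : 0 ≤ Y) {F : ℕ → ℝ}
    (hF0 : ∀ j < q, 0 ≤ F j) (hF1 : ∀ j < q, F j ≤ Y)
    (hF2 : ∀ j < q, F j * distInt (η + α * j) ≤ 1) :
    ∑ j ∈ Finset.range q, F j ≤ 3 * Y + 12 * q * (1 + Real.log q) := by
  have hq0 : (0 : ℝ) < q := by exact_mod_cast hq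
  have hqz : (0 : ℤ) < q := by exact_mod_cast hq
  set c : ℤ := round (q * η) with hc
  have hcη : |η - c / q| ≤ 1 / 2 / q := by
    have := abs_sub_round (q * η)
    rw [← hc] at this
    have h2 : η - c / q = (q * η - c) / q := by field_simp
    rw [h2, abs_div, abs_of_pos hq0]
    gcongr
  set r : ℕ → ℕ := fun j => ((c + a * j) % q).toNat with hr
  have hrcast : ∀ j, ((r j : ℕ) : ℤ) = (c + a * j) % q := fun j =>
    Int.toNat_of_nonneg (Int.emod_nonneg _ hqz.ne')
  have hrlt : ∀ j, r j < q := fun j => by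
    have := Int.emod_lt_of_pos (c + a * j) hqz
    rw [← hrcast] at this
    exact_mod_cast this
  have hinj : Set.InjOn r (Finset.range q : Set ℕ) := by
    intro i hi j hj hij
    simp only [Finset.coe_range, Set.mem_Iio] at hi hj
    have h1 : (c + a * i) % q = (c + a * j) % q := by rw [← hrcast, ← hrcast, hij]
    have h2 : (q : ℤ) ∣ a * (j - i) := by
      have h3 := (Int.ModEq.dvd (show (c + a * i) ≡ (c + a * j) [ZMOD q] from h1))
      have h4 : c + a * (j : ℤ) - (c + a * i) = a * (j - i) := by ring
      rwa [h4] at h3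
    have h3 : (q : ℤ) ∣ (j - i) := by
      refine IsCoprime.dvd_of_dvd_mul_left ?_ h2
      exact (Int.isCoprime_iff_gcd_eq_one.2 hco).symm
    have h4 : (j : ℤ) - i = 0 := by
      refine Int.eq_zero_of_abs_lt_dvd h3 ?_
      rw [abs_lt]
      omega
    omega
  set G : ℕ → ℝ := fun s => (if s = 0 then Y else 0) + (if s = 1 then Y else 0)
    + (if s = q - 1 then Y else 0) + 6 * q * (1 / ((s : ℝ) + 1))
    + 6 * q * (1 / (((q - 1 - s : ℕ) : ℝ) + 1)) with hG
  have hG0 : ∀ s, 0 ≤ G s := fun s => by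
    simp only [hG]
    positivity
  have hFG : ∀ j ∈ Finset.range q, F j ≤ G (r j) := by
    intro j hj
    rw [Finset.mem_range] at hj
    have e1 : 0 ≤ 6 * q * (1 / ((r j : ℝ) + 1)) := by positivity
    have e2 : 0 ≤ 6 * q * (1 / (((q - 1 - r j : ℕ) : ℝ) + 1)) := by positivity
    have e3 : (0 : ℝ) ≤ if r j = 0 then Y else 0 := by positivity
    have e4 : (0 : ℝ) ≤ if r j = 1 then Y else 0 := by positivity
    have e5 : (0 : ℝ) ≤ if r j = q - 1 then Y else 0 := by positivity
    have hY := hF1 j hj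
    simp only [hG]
    by_cases h0 : r j = 0
    · rw [if_pos h0]; linarith
    by_cases h1 : r j = 1
    · rw [if_pos h1]; linarith
    by_cases h2 : r j = q - 1
    · rw [if_pos h2]; linarith
    have hs2 : (2 : ℝ) ≤ r j := by
      have : 2 ≤ r j := by omega
      exact_mod_cast this
    have hlt := hrlt j
    have hqs : ((q - 1 - r j : ℕ) : ℝ) + 1 = q - r j := by
      have : ((q - 1 - r j : ℕ) : ℝ) + 1 = ((q - r j : ℕ) : ℝ) := by
        have : q - 1 - r j + 1 = q - r j := by omega
        exact_mod_cast this
      rw [this, Nat.cast_sub hlt.le]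
    have hqs2 : (2 : ℝ) ≤ q - r j := by
      have : r j + 2 ≤ q := by omega
      have : (r j : ℝ) + 2 ≤ q := by exact_mod_cast this
      linarith
    have hdiv : (r j : ℝ) + q * ((c + a * j) / q : ℤ) = c + a * j := by
      have := Int.emod_add_mul_ediv (c + a * j) q
      rw [← hrcast] at this
      exact_mod_cast this
    have happ : |(η + α * j) - (((r j : ℝ) + q * ((c + a * j) / q : ℤ)) / q)| ≤ (3 / 2) / q := by
      rw [hdiv]
      have : η + α * j - (c + a * j) / q = (η - c / q) + (α - a / q) * j := by ring
      rw [this]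
      have h5 : |(α - a / q) * j| ≤ 1 / q := by
        rw [abs_mul, abs_of_nonneg (Nat.cast_nonneg j : (0:ℝ) ≤ j)]
        have hjq : (j : ℝ) ≤ q := by exact_mod_cast hj.le
        calc |α - a / q| * j ≤ 1 / (q : ℝ) ^ 2 * q := by gcongr
          _ = 1 / q := by field_simp
      calc _ ≤ 1 / 2 / (q : ℝ) + 1 / q := (abs_add_le _ _).trans (add_le_add hcη h5)
        _ = _ := by field_simp; norm_num
    have hFj := hF2 j hj
    have hF0j := hF0 j hj
    rw [hqs] at e2 ⊢
    rcases distInt_lower_of_approx hq happ with h6 | h6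
    · have h7 : F j * ((r j - 3 / 2) / q) ≤ 1 := (mul_le_mul_of_nonneg_left h6 hF0j).trans hFj
      have h8 : F j ≤ 6 * q * (1 / ((r j : ℝ) + 1)) := by
        rw [mul_one_div, le_div_iff₀ (by positivity)]
        rw [mul_div_assoc', div_le_one hq0] at h7
        nlinarith
      linarith
    · have h7 : F j * ((q - r j - 3 / 2) / q) ≤ 1 := (mul_le_mul_of_nonneg_left h6 hF0j).trans hFj
      have h8 : F j ≤ 6 * q * (1 / (q - (r j : ℝ))) := by
        rw [mul_one_div, le_div_iff₀ (by linarith)]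
        rw [mul_div_assoc', div_le_one hq0] at h7
        nlinarith
      linarith
  calc ∑ j ∈ Finset.range q, F j ≤ ∑ j ∈ Finset.range q, G (r j) := Finset.sum_le_sum hFG
    _ = ∑ s ∈ (Finset.range q).image r, G s := (Finset.sum_image hinj).symm
    _ ≤ ∑ s ∈ Finset.range q, G s := by
      refine Finset.sum_le_sum_of_subset_of_nonneg ?_ (fun s _ _ => hG0 s)
      intro s hs
      obtain ⟨j, -, rfl⟩ := Finset.mem_image.1 hs
      exact Finset.mem_range.2 (hrlt j)
    _ ≤ Y + Y + Y + 6 * q * (1 + Real.log q) + 6 * q * (1 + Real.log q) := by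
      simp only [hG, Finset.sum_add_distrib, Finset.sum_ite_eq', ← Finset.mul_sum]
      have hrefl := Finset.sum_range_reflect (fun s : ℕ => 1 / ((s : ℝ) + 1)) q
      rw [hrefl]
      have := sum_one_div_range_le q
      gcongr <;> split_ifs <;> first | exact hY | exact le_rfl
    _ = _ := by ring

lemma sum_range_mul_eq (F : ℕ → ℝ) (M q : ℕ) :
    ∑ k ∈ Finset.range (M * q), F k
      = ∑ h ∈ Finset.range M, ∑ j ∈ Finset.range q, F (h * q + j) := by
  induction M with
  | zero => simp
  | succ M ih => rw [Nat.succ_mul, Finset.sum_range_add, ih, Finset.sum_range_succ]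

lemma sum_cappedInv_le {α : ℝ} {a : ℤ} {q : ℕ} (hq : 1 ≤ q) (hco : Int.gcd a q = 1)
    (hα : |α - (a : ℝ) / q| ≤ 1 / (q : ℝ) ^ 2) (η : ℝ) {Y : ℝ} (hY : 0 ≤ Y) (K : ℕ) :
    ∑ k ∈ Finset.range (K + 1), cappedInv Y (η + α * k)
      ≤ ((K : ℝ) / q + 1) * (3 * Y + 12 * q * (1 + Real.log q)) := by
  have hq0 : (0 : ℝ) < q := by exact_mod_cast hq
  have hK : K + 1 ≤ (K / q + 1) * q := by
    have := Nat.lt_div_mul_add (a := K) hq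
    rw [Nat.succ_mul]; exact this
  have hlog : 0 ≤ Real.log q := Real.log_natCast_nonneg q
  calc ∑ k ∈ Finset.range (K + 1), cappedInv Y (η + α * k)
      ≤ ∑ k ∈ Finset.range ((K / q + 1) * q), cappedInv Y (η + α * k) :=
        Finset.sum_le_sum_of_subset_of_nonneg (Finset.range_mono hK)
          (fun k _ _ => cappedInv_nonneg hY _)
    _ = ∑ h ∈ Finset.range (K / q + 1), ∑ j ∈ Finset.range q,
          cappedInv Y (η + α * ((h * q + j : ℕ) : ℝ)) := sum_range_mul_eq _ _ _
    _ ≤ ∑ h ∈ Finset.range (K / q + 1), (3 * Y + 12 * q * (1 + Real.log q)) := by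
        refine Finset.sum_le_sum fun h _ => ?_
        refine sum_block_le hq hco hα (η + α * (h * q)) hY (fun j _ => cappedInv_nonneg hY _)
          (fun j _ => cappedInv_le _ _) (fun j _ => ?_)
        have : η + α * (h * q) + α * j = η + α * ((h * q + j : ℕ) : ℝ) := by push_cast; ring
        rw [this]
        exact cappedInv_mul_distInt_le _ _
    _ ≤ _ := by
        rw [Finset.sum_const, Finset.card_range, nsmul_eq_mul]
        push_cast
        gcongr
        exact Nat.cast_div_le

lemma one_div_two_mul_le_distInt {α : ℝ} {a : ℤ} {q : ℕ} (hq : 1 ≤ q) (hco : Int.gcd a q = 1)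
    (hα : |α - (a : ℝ) / q| ≤ 1 / (q : ℝ) ^ 2) {k : ℕ} (hk : 1 ≤ k) (hkq : 2 * k ≤ q) :
    1 / (2 * (q : ℝ)) ≤ distInt (α * k) := by
  have hq0 : (0 : ℝ) < q := by exact_mod_cast hq
  set z := round (α * k) with hz
  have hne : a * k - q * z ≠ 0 := by
    intro h0
    have h1 : (q : ℤ) ∣ a * k := ⟨z, by linarith⟩
    have h2 : (q : ℤ) ∣ k :=
      IsCoprime.dvd_of_dvd_mul_left (Int.isCoprime_iff_gcd_eq_one.2 hco).symm h1
    have h3 : q ∣ k := by exact_mod_cast h2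
    have := Nat.le_of_dvd hk h3
    omega
  have h1 : (1 : ℝ) ≤ |(a : ℝ) * k - q * z| := by
    have := Int.one_le_abs hne
    exact_mod_cast this
  have h2 : |(α - a / q) * k| ≤ 1 / (2 * q) := by
    rw [abs_mul, abs_of_nonneg (Nat.cast_nonneg k : (0:ℝ) ≤ k)]
    have hkq' : (k : ℝ) ≤ q / 2 := by
      have : (2 : ℝ) * k ≤ q := by exact_mod_cast hkq
      linarith
    calc |α - a / q| * k ≤ 1 / (q : ℝ) ^ 2 * (q / 2) := by gcongr
      _ = 1 / (2 * q) := by field_simp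
  have h3 : 1 / (q : ℝ) ≤ |(a : ℝ) * k / q - z| := by
    have : (a : ℝ) * k / q - z = (a * k - q * z) / q := by field_simp
    rw [this, abs_div, abs_of_pos hq0]
    gcongr
  have h4 : (a : ℝ) * k / q - z = (α * k - z) - (α - a / q) * k := by ring
  have h5 := abs_sub (α * k - z) ((α - a / q) * k)
  rw [← h4] at h5
  have h6 : 1 / (q : ℝ) = 1 / (2 * q) + 1 / (2 * q) := by field_simp; norm_num
  unfold distInt
  rw [← hz]
  linarith

lemma sum_cappedInv_div_le {α : ℝ} {a : ℤ} {q : ℕ} (hq : 1 ≤ q) (hco : Int.gcd a q = 1)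
    (hα : |α - (a : ℝ) / q| ≤ 1 / (q : ℝ) ^ 2) {X : ℝ} (hX : 0 ≤ X) (K : ℕ) :
    ∑ k ∈ Finset.range K, cappedInv (X / ((k : ℝ) + 1)) (α * ((k : ℝ) + 1))
      ≤ 6 * X / q * (1 + Real.log (K + 1)) + ((K : ℝ) + q) * (6 + 12 * (1 + Real.log q)) := by
  have hq0 : (0 : ℝ) < q := by exact_mod_cast hq
  have hK : K ≤ (K / q + 1) * q := by
    have := Nat.lt_div_mul_add (a := K) hq
    rw [Nat.succ_mul]; exact this.le
  have hlog : 0 ≤ Real.log q := Real.log_natCast_nonneg q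
  have hdivK : ((K / q : ℕ) : ℝ) ≤ K / q := Nat.cast_div_le
  have hnn : ∀ k : ℕ, 0 ≤ cappedInv (X / ((k : ℝ) + 1)) (α * ((k : ℝ) + 1)) :=
    fun k => cappedInv_nonneg (by positivity) _
  calc ∑ k ∈ Finset.range K, cappedInv (X / ((k : ℝ) + 1)) (α * ((k : ℝ) + 1))
      ≤ ∑ k ∈ Finset.range ((K / q + 1) * q),
          cappedInv (X / ((k : ℝ) + 1)) (α * ((k : ℝ) + 1)) :=
        Finset.sum_le_sum_of_subset_of_nonneg (Finset.range_mono hK) (fun k _ _ => hnn k)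
    _ = ∑ h ∈ Finset.range (K / q + 1), ∑ j ∈ Finset.range q,
          cappedInv (X / (((h * q + j : ℕ) : ℝ) + 1)) (α * (((h * q + j : ℕ) : ℝ) + 1)) :=
        sum_range_mul_eq _ _ _
    _ ≤ ∑ h ∈ Finset.range (K / q + 1),
          (3 * (2 * X / q * (1 / ((h : ℝ) + 1)) + 2 * q) + 12 * q * (1 + Real.log q)) := by
        refine Finset.sum_le_sum fun h _ => ?_
        refine sum_block_le hq hco hα (α * (h * q + 1)) (by positivity) (fun j _ => hnn _)
          (fun j hj => ?_) (fun j _ => ?_)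
        · by_cases hbig : (h + 1) * q ≤ 2 * (h * q + j + 1)
          · refine (cappedInv_le _ _).trans ?_
            have hb : ((h : ℝ) + 1) * q ≤ 2 * (h * q + j + 1) := by exact_mod_cast hbig
            have : X / (((h * q + j : ℕ) : ℝ) + 1) ≤ 2 * X / q * (1 / ((h : ℝ) + 1)) := by
              rw [div_mul_div_comm, mul_one, div_le_div_iff₀ (by positivity) (by positivity)]
              push_cast
              nlinarith
            linarith
          · have h0 : h = 0 := by
              by_contra hne
              have : 1 ≤ h := by omega
              nlinarith
            subst h0
            have hd := one_div_two_mul_le_distInt hq hco hα (k := j + 1) (by omega) (by omega)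
            have hm := cappedInv_mul_distInt_le (X / (((0 * q + j : ℕ) : ℝ) + 1))
              (α * (((0 * q + j : ℕ) : ℝ) + 1))
            have hn := hnn (0 * q + j)
            have heq : α * ((j + 1 : ℕ) : ℝ) = α * (((0 * q + j : ℕ) : ℝ) + 1) := by
              push_cast; ring
            rw [heq] at hd
            have h9 := (mul_le_mul_of_nonneg_left hd hn).trans hm
            rw [mul_one_div, div_le_one (by positivity)] at h9
            have : 0 ≤ 2 * X / q * (1 / (((0 : ℕ) : ℝ) + 1)) := by positivity
            linarith
        · have : α * (h * q + 1) + α * j = α * (((h * q + j : ℕ) : ℝ) + 1) := by push_cast; ring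
          rw [this]
          exact cappedInv_mul_distInt_le _ _
    _ = 6 * X / q * ∑ h ∈ Finset.range (K / q + 1), 1 / ((h : ℝ) + 1)
          + ((K / q : ℕ) + 1 : ℝ) * (q * (6 + 12 * (1 + Real.log q))) := by
        rw [Finset.mul_sum]
        have : ((K / q : ℕ) + 1 : ℝ) * (q * (6 + 12 * (1 + Real.log q)))
            = ∑ h ∈ Finset.range (K / q + 1), q * (6 + 12 * (1 + Real.log q)) := by
          rw [Finset.sum_const, Finset.card_range, nsmul_eq_mul]; push_cast; ring
        rw [this, ← Finset.sum_add_distrib]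
        exact Finset.sum_congr rfl fun h _ => by ring
    _ ≤ 6 * X / q * (1 + Real.log (K + 1))
          + ((K : ℝ) / q + 1) * (q * (6 + 12 * (1 + Real.log q))) := by
        gcongr
        refine (sum_one_div_range_le _).trans ?_
        have : ((K / q + 1 : ℕ) : ℝ) ≤ (K : ℝ) + 1 := by
          have := Nat.div_le_self K q
          exact_mod_cast Nat.succ_le_succ this
        gcongr
    _ = _ := by field_simp

lemma conj_e (x : ℝ) : (starRingEnd ℂ) (e x) = e (-x) := by
  simp only [e]
  rw [← Complex.exp_conj]
  simp [map_ofNat]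

lemma norm_sum_periodic_le_cappedInv {g : ℕ} (hg : 1 ≤ g) {c : ℕ → ℂ}
    (hc : ∀ m, c (m + g) = c m) (hc1 : ∀ m, ‖c m‖ ≤ 1) (θ : ℝ) {a b : ℕ} {Y : ℝ}
    (hab : a ≤ b) (hY : ((b - a : ℕ) : ℝ) ≤ Y) :
    ‖∑ m ∈ Finset.Ico a b, c m * e (θ * m)‖ ≤ g * cappedInv Y (θ * g) := by
  have hg1 : (1 : ℝ) ≤ g := by exact_mod_cast hg
  have hg0 : (0 : ℝ) < g := by linarith
  have htriv : ‖∑ m ∈ Finset.Ico a b, c m * e (θ * m)‖ ≤ Y := by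
    refine le_trans ?_ hY
    refine (norm_sum_le_of_le _ (fun m _ => ?_ : ∀ m ∈ Finset.Ico a b, _ ≤ (1 : ℝ))).trans ?_
    · rw [norm_mul, norm_e, mul_one]; exact hc1 m
    · simp
  rw [← div_le_iff₀' hg0]
  refine le_cappedInv ?_ ?_
  · exact (div_le_self (norm_nonneg _) hg1).trans htriv
  · rw [div_mul_eq_mul_div, div_le_one hg0]
    exact norm_sum_periodic_mul_distInt_le hc hc1 θ hab

lemma sum_log_mul_eq (F : ℕ → ℂ) (M : ℕ) :
    ∑ m ∈ Finset.Ioc 0 M, (Real.log m : ℂ) * F m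
      = (Real.log M : ℂ) * ∑ m ∈ Finset.Ioc 0 M, F m
        - ∑ j ∈ Finset.range M, ((Real.log (j + 1 : ℕ) - Real.log j : ℝ) : ℂ)
            * ∑ m ∈ Finset.Ioc 0 j, F m := by
  induction M with
  | zero => simp
  | succ M ih =>
    rw [Finset.sum_Ioc_succ_top (Nat.zero_le _), Finset.sum_Ioc_succ_top (Nat.zero_le _),
      Finset.sum_range_succ, ih]
    push_cast
    ring

lemma norm_sum_log_mul_le {F : ℕ → ℂ} {M : ℕ} {T : ℝ}
    (hT : ∀ j ≤ M, ‖∑ m ∈ Finset.Ioc 0 j, F m‖ ≤ T) :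
    ‖∑ m ∈ Finset.Ioc 0 M, (Real.log m : ℂ) * F m‖ ≤ 2 * Real.log M * T := by
  have hT0 : 0 ≤ T := (norm_nonneg _).trans (hT 0 (Nat.zero_le _))
  have hlog : 0 ≤ Real.log M := Real.log_natCast_nonneg M
  have hδ : ∀ j : ℕ, 0 ≤ Real.log (j + 1 : ℕ) - Real.log j := fun j => by
    rcases Nat.eq_zero_or_pos j with rfl | hj
    · simp
    · have : (0 : ℝ) < j := by exact_mod_cast hj
      rw [sub_nonneg]
      apply Real.log_le_log this
      push_cast; linarith
  have h1 : ‖(Real.log M : ℂ) * ∑ m ∈ Finset.Ioc 0 M, F m‖ ≤ Real.log M * T := by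
    rw [norm_mul, Complex.norm_real, Real.norm_of_nonneg hlog]
    exact mul_le_mul_of_nonneg_left (hT M le_rfl) hlog
  have h2 : ‖∑ j ∈ Finset.range M, ((Real.log (j + 1 : ℕ) - Real.log j : ℝ) : ℂ)
      * ∑ m ∈ Finset.Ioc 0 j, F m‖ ≤ Real.log M * T := by
    calc _ ≤ ∑ j ∈ Finset.range M, (Real.log (j + 1 : ℕ) - Real.log j) * T := by
          refine norm_sum_le_of_le _ fun j hj => ?_
          rw [norm_mul, Complex.norm_real, Real.norm_of_nonneg (hδ j)]
          exact mul_le_mul_of_nonneg_left (hT j (Finset.mem_range.1 hj).le) (hδ j)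
      _ = Real.log M * T := by
          rw [← Finset.sum_mul, Finset.sum_range_sub (fun j : ℕ => Real.log j)]
          simp
  rw [sum_log_mul_eq]
  refine (norm_sub_le _ _).trans ?_
  linarith

lemma sum_cappedInv_multiples_le {α : ℝ} {a : ℤ} {q : ℕ} (hq : 1 ≤ q) (hco : Int.gcd a q = 1)
    (hα : |α - (a : ℝ) / q| ≤ 1 / (q : ℝ) ^ 2) {B : ℕ} (hB : 1 ≤ B) {X : ℝ} (hX : 0 ≤ X) (D : ℕ) :
    ∑ d ∈ Finset.Ioc 0 D, cappedInv (X / d) (α * (B * d))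
      ≤ 6 * (B * X) / q * (1 + Real.log ((B * D : ℕ) + 1))
        + (((B * D : ℕ) : ℝ) + q) * (6 + 12 * (1 + Real.log q)) := by
  have hB0 : (0 : ℝ) < B := by exact_mod_cast hB
  refine le_trans ?_ (sum_cappedInv_div_le hq hco hα (X := B * X) (by positivity) (B * D))
  have hinj : Set.InjOn (fun d : ℕ => B * d - 1) (Finset.Ioc 0 D : Set ℕ) := by
    intro i hi j hj hij
    simp only [Finset.coe_Ioc, Set.mem_Ioc] at hi hj
    have h1 : 1 ≤ B * i := Nat.mul_pos hB hi.1
    have h2 : 1 ≤ B * j := Nat.mul_pos hB hj.1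
    have h3 : B * i = B * j := by simp only at hij; omega
    exact Nat.eq_of_mul_eq_mul_left hB h3
  calc ∑ d ∈ Finset.Ioc 0 D, cappedInv (X / d) (α * (B * d))
      = ∑ d ∈ Finset.Ioc 0 D, cappedInv (B * X / (((B * d - 1 : ℕ) : ℝ) + 1))
          (α * (((B * d - 1 : ℕ) : ℝ) + 1)) := by
        refine Finset.sum_congr rfl fun d hd => ?_
        have hd1 := (Finset.mem_Ioc.1 hd).1
        have hd0 : (0 : ℝ) < d := by exact_mod_cast hd1
        have h1 : 1 ≤ B * d := Nat.mul_pos hB hd1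
        have h2 : ((B * d - 1 : ℕ) : ℝ) + 1 = B * d := by
          rw [Nat.cast_sub h1]; push_cast; ring
        rw [h2, mul_div_mul_left _ _ hB0.ne']
    _ = ∑ k ∈ (Finset.Ioc 0 D).image (fun d : ℕ => B * d - 1),
          cappedInv (B * X / ((k : ℝ) + 1)) (α * ((k : ℝ) + 1)) :=
        (Finset.sum_image (f := fun k : ℕ => cappedInv (B * X / ((k : ℝ) + 1)) (α * ((k : ℝ) + 1)))
          hinj).symm
    _ ≤ _ := by
        refine Finset.sum_le_sum_of_subset_of_nonneg ?_
          (fun k _ _ => cappedInv_nonneg (by positivity) _)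
        intro k hk
        obtain ⟨d, hd, rfl⟩ := Finset.mem_image.1 hk
        have hd1 := Finset.mem_Ioc.1 hd
        have h1 : 1 ≤ B * d := Nat.mul_pos hB hd1.1
        have h2 : B * d ≤ B * D := Nat.mul_le_mul_left B hd1.2
        simp only [Finset.mem_range]
        omega

lemma sum_multiples_le {F : ℕ → ℝ} (hF : ∀ k, 0 ≤ F k) {A : ℕ} (hA : 0 < A) (R : ℕ) :
    ∑ n ∈ Finset.Ioc 0 R, F (A * n) ≤ ∑ k ∈ Finset.range (A * R + 1), F k := by
  have hinj : Set.InjOn (fun n : ℕ => A * n) (Finset.Ioc 0 R : Set ℕ) :=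
    fun i _ j _ hij => Nat.eq_of_mul_eq_mul_left hA hij
  rw [← Finset.sum_image hinj]
  refine Finset.sum_le_sum_of_subset_of_nonneg ?_ (fun k _ _ => hF k)
  intro k hk
  obtain ⟨n, hn, rfl⟩ := Finset.mem_image.1 hk
  have := Nat.mul_le_mul_left A (Finset.mem_Ioc.1 hn).2
  simp only [Finset.mem_range]
  omega

lemma norm_sum_e_le_cappedInv (θ : ℝ) {N B n₁ n₂ : ℕ} (h₁ : 0 < n₁) (h₂ : 0 < n₂) :
    ‖∑ b ∈ (Finset.Ico B (2 * B)).filter (fun b => b * n₁ ≤ N ∧ b * n₂ ≤ N), e (θ * b)‖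
      ≤ cappedInv B θ := by
  set t := min (2 * B) (min (N / n₁ + 1) (N / n₂ + 1)) with ht
  have hset : (Finset.Ico B (2 * B)).filter (fun b => b * n₁ ≤ N ∧ b * n₂ ≤ N)
      = Finset.Ico B t := by
    ext b
    simp only [Finset.mem_filter, Finset.mem_Ico, ht, lt_min_iff, Nat.lt_succ_iff,
      Nat.le_div_iff_mul_le h₁, Nat.le_div_iff_mul_le h₂]
    tauto
  rw [hset]
  rcases le_total B t with hBt | hBt
  · have := norm_sum_periodic_le_cappedInv (g := 1) le_rfl (c := fun _ => 1) (fun _ => rfl)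
      (fun _ => by simp) θ hBt (Y := B) (by
        have : t - B ≤ B := by
          have : t ≤ 2 * B := min_le_left _ _
          omega
        exact_mod_cast this)
    simpa using this
  · rw [Finset.Ico_eq_empty_of_le hBt]
    simpa using cappedInv_nonneg (Nat.cast_nonneg B) θ

lemma sum_norm_sq_le (θ : ℝ) {N B R : ℕ} {β : ℕ → ℂ} {L : ℝ} (hβ : ∀ n, ‖β n‖ ≤ L) :
    ∑ b ∈ Finset.Ico B (2 * B),
        ‖∑ n ∈ Finset.Ioc 0 R, if b * n ≤ N then β n * e (θ * (b * n)) else 0‖ ^ 2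
      ≤ L ^ 2 * ∑ n₂ ∈ Finset.Ioc 0 R, ∑ n₁ ∈ Finset.Ioc 0 R, cappedInv B (θ * (n₁ - n₂)) := by
  have hL : 0 ≤ L := (norm_nonneg _).trans (hβ 0)
  set W : ℕ → ℂ := fun b => ∑ n ∈ Finset.Ioc 0 R, if b * n ≤ N then β n * e (θ * (b * n)) else 0
    with hW
  have hkey : ((∑ b ∈ Finset.Ico B (2 * B), ‖W b‖ ^ 2 : ℝ) : ℂ)
      = ∑ n₂ ∈ Finset.Ioc 0 R, ∑ n₁ ∈ Finset.Ioc 0 R, β n₁ * (starRingEnd ℂ) (β n₂)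
        * ∑ b ∈ (Finset.Ico B (2 * B)).filter (fun b => b * n₁ ≤ N ∧ b * n₂ ≤ N),
            e (θ * (n₁ - n₂) * b) := by
    push_cast
    calc ∑ b ∈ Finset.Ico B (2 * B), (‖W b‖ : ℂ) ^ 2
        = ∑ b ∈ Finset.Ico B (2 * B), ∑ n₂ ∈ Finset.Ioc 0 R, ∑ n₁ ∈ Finset.Ioc 0 R,
            (if b * n₁ ≤ N ∧ b * n₂ ≤ N then
              β n₁ * (starRingEnd ℂ) (β n₂) * e (θ * (n₁ - n₂) * b) else 0) := by
          refine Finset.sum_congr rfl fun b _ => ?_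
          rw [← Complex.mul_conj', hW]
          simp only [map_sum]
          rw [Finset.mul_sum]
          refine Finset.sum_congr rfl fun n₂ _ => ?_
          rw [Finset.sum_mul]
          refine Finset.sum_congr rfl fun n₁ _ => ?_
          by_cases h1 : b * n₁ ≤ N <;> by_cases h2 : b * n₂ ≤ N <;> simp only [h1, h2, if_true,
            if_false, and_true, and_false, map_zero, mul_zero, zero_mul]
          have : θ * (n₁ - n₂) * b = θ * (b * n₁) + -(θ * (b * n₂)) := by ring
          rw [this, e_add, map_mul, conj_e]
          ring
      _ = _ := by
          rw [Finset.sum_comm]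
          refine Finset.sum_congr rfl fun n₂ _ => ?_
          rw [Finset.sum_comm]
          refine Finset.sum_congr rfl fun n₁ _ => ?_
          rw [Finset.mul_sum, Finset.sum_filter]
  have hnn : 0 ≤ ∑ b ∈ Finset.Ico B (2 * B), ‖W b‖ ^ 2 := Finset.sum_nonneg fun _ _ => by positivity
  rw [← Real.norm_of_nonneg hnn, ← Complex.norm_real, hkey, Finset.mul_sum]
  refine norm_sum_le_of_le _ fun n₂ hn₂ => ?_
  rw [Finset.mul_sum]
  refine norm_sum_le_of_le _ fun n₁ hn₁ => ?_
  rw [norm_mul, norm_mul, RCLike.norm_conj, pow_two]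
  have := norm_sum_e_le_cappedInv (θ * (n₁ - n₂)) (N := N) (B := B)
    (Finset.mem_Ioc.1 hn₁).1 (Finset.mem_Ioc.1 hn₂).1
  have h1 := hβ n₁
  have h2 := hβ n₂
  gcongr

lemma bilinear_sq_le {α : ℝ} {a : ℤ} {q : ℕ} (hq : 1 ≤ q) (hco : Int.gcd a q = 1)
    (hα : |α - (a : ℝ) / q| ≤ 1 / (q : ℝ) ^ 2) {A : ℕ} (hA : 0 < A) {N B : ℕ} (hB : 0 < B)
    {γ β : ℕ → ℂ} {L : ℝ} (hγ : ∀ b, ‖γ b‖ ≤ 1) (hβ : ∀ n, ‖β n‖ ≤ L) :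
    ‖∑ b ∈ Finset.Ico B (2 * B), ∑ n ∈ Finset.Ioc 0 (N / b),
        γ b * β n * e (α * (A * ((b * n : ℕ) : ℝ)))‖ ^ 2
      ≤ L ^ 2 * N * ((A * N / (B * q) + 1) * (3 * B + 12 * q * (1 + Real.log q))) := by
  have hB0 : (0 : ℝ) < B := by exact_mod_cast hB
  have hq0 : (0 : ℝ) < q := by exact_mod_cast hq
  have hlog : 0 ≤ Real.log q := Real.log_natCast_nonneg q
  set R := N / B with hR
  have hRle : (R : ℝ) ≤ N / B := Nat.cast_div_le
  set W : ℕ → ℂ := fun b => ∑ n ∈ Finset.Ioc 0 R,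
    if b * n ≤ N then β n * e (α * A * (b * n)) else 0 with hW
  have hSW : ∀ b ∈ Finset.Ico B (2 * B), ∑ n ∈ Finset.Ioc 0 (N / b),
      γ b * β n * e (α * (A * ((b * n : ℕ) : ℝ))) = γ b * W b := by
    intro b hb
    have hBb := (Finset.mem_Ico.1 hb).1
    have hb0 : 0 < b := lt_of_lt_of_le hB hBb
    rw [hW]
    simp only
    rw [← Finset.sum_filter, Finset.mul_sum]
    refine Finset.sum_congr ?_ fun n _ => ?_
    · ext n
      simp only [Finset.mem_Ioc, Finset.mem_filter, Nat.le_div_iff_mul_le hb0, hR,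
        Nat.le_div_iff_mul_le hB, mul_comm b n]
      constructor
      · rintro ⟨h1, h2⟩
        exact ⟨⟨h1, (Nat.mul_le_mul_left n hBb).trans h2⟩, h2⟩
      · rintro ⟨⟨h1, _⟩, h2⟩
        exact ⟨h1, h2⟩
    · rw [mul_assoc]
      push_cast
      ring_nf
  rw [Finset.sum_congr rfl hSW]
  have hCS : ‖∑ b ∈ Finset.Ico B (2 * B), γ b * W b‖ ^ 2
      ≤ B * ∑ b ∈ Finset.Ico B (2 * B), ‖W b‖ ^ 2 := by
    calc _ ≤ (∑ b ∈ Finset.Ico B (2 * B), ‖W b‖) ^ 2 := by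
          gcongr
          refine norm_sum_le_of_le _ fun b _ => ?_
          rw [norm_mul]
          exact mul_le_of_le_one_left (norm_nonneg _) (hγ b)
      _ ≤ ((Finset.Ico B (2 * B)).card : ℝ) * ∑ b ∈ Finset.Ico B (2 * B), ‖W b‖ ^ 2 :=
          sq_sum_le_card_mul_sum_sq
      _ = _ := by
          rw [Nat.card_Ico, show 2 * B - B = B by omega]
  have hinner : ∀ n₂ ∈ Finset.Ioc 0 R, ∑ n₁ ∈ Finset.Ioc 0 R, cappedInv B (α * A * (n₁ - n₂))
      ≤ (A * N / (B * q) + 1) * (3 * B + 12 * q * (1 + Real.log q)) := by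
    intro n₂ _
    have h1 := sum_multiples_le (F := fun k => cappedInv B (-(α * A * n₂) + α * k))
      (fun k => cappedInv_nonneg hB0.le _) hA R
    have h2 := sum_cappedInv_le hq hco hα (-(α * A * n₂)) hB0.le (A * R)
    calc _ = ∑ n ∈ Finset.Ioc 0 R, cappedInv B (-(α * A * n₂) + α * ((A * n : ℕ) : ℝ)) := by
          refine Finset.sum_congr rfl fun n _ => ?_
          congr 1; push_cast; ring
      _ ≤ _ := h1.trans h2
      _ ≤ _ := by
          have : (((A * R : ℕ) : ℝ)) / q ≤ A * N / (B * q) := by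
            push_cast
            calc (A : ℝ) * R / q ≤ A * (N / B) / q := by gcongr
              _ = _ := by field_simp
          gcongr
  have hsum := sum_norm_sq_le (α * A) (N := N) (B := B) (R := R) hβ
  calc _ ≤ _ := hCS
    _ ≤ B * (L ^ 2 * ∑ n₂ ∈ Finset.Ioc 0 R,
          ((A * N / (B * q) + 1) * (3 * B + 12 * q * (1 + Real.log q)))) := by
        gcongr
        refine hsum.trans ?_
        gcongr with n₂ hn₂
        exact hinner n₂ hn₂
    _ = (B * R) * (L ^ 2 * ((A * N / (B * q) + 1) * (3 * B + 12 * q * (1 + Real.log q)))) := by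
        rw [Finset.sum_const, Nat.card_Ioc, Nat.sub_zero, nsmul_eq_mul]; ring
    _ ≤ N * (L ^ 2 * ((A * N / (B * q) + 1) * (3 * B + 12 * q * (1 + Real.log q)))) := by
        gcongr
        rw [mul_comm]
        exact (le_div_iff₀ hB0).1 hRle
    _ = _ := by ring

open ArithmeticFunction in
lemma sum_Ioc_convolution_mul (u v : ArithmeticFunction ℝ) (f : ℕ → ℂ) (N : ℕ) :
    ∑ n ∈ Finset.Ioc 0 N, ((u * v) n : ℂ) * f n
      = ∑ b ∈ Finset.Ioc 0 N, ∑ m ∈ Finset.Ioc 0 (N / b), (u b : ℂ) * (v m : ℂ) * f (b * m) := by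
  have h1 : ∀ n ∈ Finset.Ioc 0 N, ((u * v) n : ℂ) * f n
      = ∑ x ∈ Finset.Ioc 0 N ×ˢ Finset.Ioc 0 N, if x.1 * x.2 = n then
          (u x.1 : ℂ) * (v x.2 : ℂ) * f (x.1 * x.2) else 0 := by
    intro n hn
    have hn' := Finset.mem_Ioc.1 hn
    rw [mul_apply, Nat.divisorsAntidiagonal_eq_prod_filter_of_le hn'.1.ne' hn'.2,
      ← Finset.sum_filter]
    push_cast
    rw [Finset.sum_mul]
    refine Finset.sum_congr (by ext; simp) fun x hx => ?_
    rw [(Finset.mem_filter.1 hx).2]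
  rw [Finset.sum_congr rfl h1, Finset.sum_comm, Finset.sum_product]
  refine Finset.sum_congr rfl fun b hb => ?_
  have hb0 := (Finset.mem_Ioc.1 hb).1
  have hsub : Finset.Ioc 0 (N / b) = (Finset.Ioc 0 N).filter (fun m => b * m ≤ N) := by
    ext m
    simp only [Finset.mem_Ioc, Finset.mem_filter, Nat.le_div_iff_mul_le hb0, mul_comm b m]
    constructor
    · rintro ⟨h1, h2⟩
      exact ⟨⟨h1, (Nat.le_mul_of_pos_right m hb0).trans h2⟩, h2⟩
    · rintro ⟨⟨h1, _⟩, h2⟩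
      exact ⟨h1, h2⟩
  rw [hsub, Finset.sum_filter]
  refine Finset.sum_congr rfl fun m hm => ?_
  have hm0 := (Finset.mem_Ioc.1 hm).1
  rw [Finset.sum_ite_eq]
  simp [Nat.mul_pos hb0 hm0]

/-- The restriction of an arithmetic function to `n ≤ U`. -/
noncomputable def lowPart (U : ℕ) (f : ArithmeticFunction ℝ) : ArithmeticFunction ℝ :=
  ⟨fun n => if n ≤ U then f n else 0, by simp⟩

/-- The restriction of an arithmetic function to `n > U`. -/
noncomputable def highPart (U : ℕ) (f : ArithmeticFunction ℝ) : ArithmeticFunction ℝ :=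
  ⟨fun n => if n ≤ U then 0 else f n, by simp⟩

lemma lowPart_apply (U : ℕ) (f : ArithmeticFunction ℝ) (n : ℕ) :
    lowPart U f n = if n ≤ U then f n else 0 := rfl

lemma highPart_apply (U : ℕ) (f : ArithmeticFunction ℝ) (n : ℕ) :
    highPart U f n = if n ≤ U then 0 else f n := rfl

lemma lowPart_add_highPart (U : ℕ) (f : ArithmeticFunction ℝ) :
    lowPart U f + highPart U f = f := by
  ext n
  rw [ArithmeticFunction.add_apply, lowPart_apply, highPart_apply]
  split_ifs <;> simp

open ArithmeticFunction ArithmeticFunction.Moebius ArithmeticFunction.zeta in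
/-- Vaughan's identity. -/
lemma vaughan_identity (U : ℕ) :
    (Λ : ArithmeticFunction ℝ) = lowPart U Λ + lowPart U (μ : ArithmeticFunction ℝ) * log
      - lowPart U Λ * lowPart U (μ : ArithmeticFunction ℝ) * (ζ : ArithmeticFunction ℝ)
      + highPart U (μ : ArithmeticFunction ℝ) * (highPart U Λ * (ζ : ArithmeticFunction ℝ)) := by
  have h1 := lowPart_add_highPart U Λ
  have h2 := lowPart_add_highPart U (μ : ArithmeticFunction ℝ)
  have h3 : ((μ : ArithmeticFunction ℝ) * (ζ : ArithmeticFunction ℝ)) = 1 :=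
    coe_moebius_mul_coe_zeta
  have h4 := vonMangoldt_mul_zeta
  linear_combination (-1 + lowPart U (μ : ArithmeticFunction ℝ) * (ζ : ArithmeticFunction ℝ)) * h1
    - highPart U Λ * (ζ : ArithmeticFunction ℝ) * h2 - highPart U Λ * h3
    + lowPart U (μ : ArithmeticFunction ℝ) * h4

open ArithmeticFunction ArithmeticFunction.Moebius in
lemma abs_lowPart_moebius_le (U n : ℕ) : |lowPart U (μ : ArithmeticFunction ℝ) n| ≤ 1 := by
  rw [lowPart_apply]
  split_ifs
  · rw [intCoe_apply]
    exact_mod_cast abs_moebius_le_one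
  · simp

open ArithmeticFunction ArithmeticFunction.Moebius in
lemma abs_highPart_moebius_le (U n : ℕ) : |highPart U (μ : ArithmeticFunction ℝ) n| ≤ 1 := by
  rw [highPart_apply]
  split_ifs
  · simp
  · rw [intCoe_apply]
    exact_mod_cast abs_moebius_le_one

open ArithmeticFunction in
/-- Convolving a part of `Λ` with a function bounded by `1` gives at most `log`. -/
lemma abs_mul_le_log {u v : ArithmeticFunction ℝ} (hu : ∀ n, |u n| ≤ Λ n) (hv : ∀ n, |v n| ≤ 1)
    (n : ℕ) : |(u * v) n| ≤ Real.log n := by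
  rw [mul_apply, ← vonMangoldt_sum, ← Nat.map_div_right_divisors, Finset.sum_map]
  refine (Finset.abs_sum_le_sum_abs _ _).trans (Finset.sum_le_sum fun d _ => ?_)
  rw [abs_mul]
  exact (mul_le_of_le_one_right (abs_nonneg _) (hv _)).trans (hu _)

open ArithmeticFunction in
lemma abs_lowPart_vonMangoldt_le (U n : ℕ) : |lowPart U Λ n| ≤ Λ n := by
  rw [lowPart_apply]
  split_ifs
  · rw [abs_of_nonneg vonMangoldt_nonneg]
  · simp

open ArithmeticFunction in
lemma abs_highPart_vonMangoldt_le (U n : ℕ) : |highPart U Λ n| ≤ Λ n := by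
  rw [highPart_apply]
  split_ifs
  · simp
  · rw [abs_of_nonneg vonMangoldt_nonneg]

lemma lowPart_mul_lowPart_eq_zero {U n : ℕ} (f h : ArithmeticFunction ℝ) (hn : U * U < n) :
    (lowPart U f * lowPart U h) n = 0 := by
  rw [ArithmeticFunction.mul_apply]
  refine Finset.sum_eq_zero fun x hx => ?_
  rw [lowPart_apply, lowPart_apply]
  have hx' := (Nat.mem_divisorsAntidiagonal.1 hx).1
  split_ifs with h1 h2
  · have := Nat.mul_le_mul h1 h2
    omega
  all_goals simp

lemma highPart_mul_eq_zero {U n : ℕ} (f h : ArithmeticFunction ℝ) (hn : n ≤ U) :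
    (highPart U f * h) n = 0 := by
  rw [ArithmeticFunction.mul_apply]
  refine Finset.sum_eq_zero fun x hx => ?_
  obtain ⟨hx1, hx2⟩ := Nat.mem_divisorsAntidiagonal.1 hx
  have : x.1 ≤ U := (Nat.le_of_dvd (Nat.pos_of_ne_zero hx2) ⟨x.2, hx1.symm⟩).trans hn
  rw [highPart_apply, if_pos this, zero_mul]

lemma norm_linear_sum_le {g : ℕ} (hg : 1 ≤ g) {c : ℕ → ℂ} (hc : ∀ m, c (m + g) = c m)
    (hc1 : ∀ m, ‖c m‖ ≤ 1) (α : ℝ) (A : ℕ) {N d j : ℕ} (hj : j ≤ N / d) :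
    ‖∑ m ∈ Finset.Ioc 0 j, c m * e (α * (A * ((d * m : ℕ) : ℝ)))‖
      ≤ g * cappedInv ((N : ℝ) / d) (α * ((A * g : ℕ) * d)) := by
  have hY : ((j + 1 - 1 : ℕ) : ℝ) ≤ (N : ℝ) / d := by
    refine le_trans ?_ (Nat.cast_div_le (m := N) (n := d))
    exact_mod_cast (by simpa using hj)
  have h := norm_sum_periodic_le_cappedInv hg hc hc1 (α * A * d) (a := 1) (b := j + 1)
    (by omega) hY
  have hs : Finset.Ioc 0 j = Finset.Ico 1 (j + 1) := by ext; simp; omega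
  have e1 : α * ((A * g : ℕ) * d) = α * A * d * g := by push_cast; ring
  rw [hs, e1]
  refine le_trans (le_of_eq ?_) h
  congr 1
  refine Finset.sum_congr rfl fun m _ => ?_
  push_cast
  ring_nf

section pieces

open ArithmeticFunction ArithmeticFunction.Moebius ArithmeticFunction.zeta

variable {A g N U : ℕ} {c : ℕ → ℂ} {α : ℝ}

lemma norm_sum_lowPart_le (hc1 : ∀ m, ‖c m‖ ≤ 1) (hU : U ≤ N) :
    ‖∑ n ∈ Finset.Ioc 0 N, (lowPart U Λ n : ℂ) * (c n * e (α * (A * (n : ℝ))))‖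
      ≤ U * Real.log N := by
  have hs : Finset.Ioc 0 U ⊆ Finset.Ioc 0 N := Finset.Ioc_subset_Ioc_right hU
  rw [← Finset.sum_subset hs]
  · refine (norm_sum_le_of_le _ (fun n hn => ?_ : ∀ n ∈ Finset.Ioc 0 U, _ ≤ Real.log N)).trans ?_
    · have hn' := Finset.mem_Ioc.1 hn
      rw [norm_mul, norm_mul, norm_e, mul_one, Complex.norm_real, Real.norm_eq_abs]
      refine (mul_le_of_le_one_right (abs_nonneg _) (hc1 n)).trans ?_
      refine (abs_lowPart_vonMangoldt_le U n).trans (vonMangoldt_le_log.trans ?_)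
      have : (0 : ℝ) < n := by exact_mod_cast hn'.1
      apply Real.log_le_log this
      exact_mod_cast hn'.2.trans hU
    · simp
  · intro n hn hn2
    have : ¬ n ≤ U := fun h => hn2 (Finset.mem_Ioc.2 ⟨(Finset.mem_Ioc.1 hn).1, h⟩)
    simp [lowPart_apply, this]

lemma norm_sum_moebius_log_le (hg : 1 ≤ g)
    (hc : ∀ m, c (m + g) = c m) (hc1 : ∀ m, ‖c m‖ ≤ 1) (hcm : ∀ m n, c (m * n) = c m * c n)
    (hU : U * U ≤ N) :
    ‖∑ n ∈ Finset.Ioc 0 N, ((lowPart U (μ : ArithmeticFunction ℝ) * log) n : ℂ)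
        * (c n * e (α * (A * (n : ℝ))))‖
      ≤ 2 * g * Real.log N *
        ∑ d ∈ Finset.Ioc 0 (U * U), cappedInv ((N : ℝ) / d) (α * ((A * g : ℕ) * d)) := by
  have hnn : ∀ d : ℕ, 0 ≤ cappedInv ((N : ℝ) / d) (α * ((A * g : ℕ) * d)) :=
    fun d => cappedInv_nonneg (by positivity) _
  have hlogN : 0 ≤ Real.log N := Real.log_natCast_nonneg N
  rw [sum_Ioc_convolution_mul _ _ (fun n => c n * e (α * (A * (n : ℝ)))),
    ← Finset.sum_subset (Finset.Ioc_subset_Ioc_right hU), Finset.mul_sum]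
  · refine norm_sum_le_of_le _ fun d hd => ?_
    have hd0 := (Finset.mem_Ioc.1 hd).1
    have hd1 := (Finset.mem_Ioc.1 hd).2
    have h1 : ∑ m ∈ Finset.Ioc 0 (N / d), (lowPart U (μ : ArithmeticFunction ℝ) d : ℂ)
          * (log m : ℂ) * (c (d * m) * e (α * (A * ((d * m : ℕ) : ℝ))))
        = (lowPart U (μ : ArithmeticFunction ℝ) d : ℂ) * c d *
          ∑ m ∈ Finset.Ioc 0 (N / d), (Real.log m : ℂ)
            * (c m * e (α * (A * ((d * m : ℕ) : ℝ)))) := by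
      rw [Finset.mul_sum]
      refine Finset.sum_congr rfl fun m _ => ?_
      rw [hcm, log_apply]
      ring
    have h2 := norm_sum_log_mul_le (M := N / d)
      (F := fun m => c m * e (α * (A * ((d * m : ℕ) : ℝ))))
      (fun j hj => norm_linear_sum_le hg hc hc1 α A (N := N) hj)
    rw [h1, norm_mul, norm_mul, Complex.norm_real, Real.norm_eq_abs]
    have h3 : |lowPart U (μ : ArithmeticFunction ℝ) d| * ‖c d‖ ≤ 1 :=
      mul_le_one₀ (abs_lowPart_moebius_le U d) (norm_nonneg _) (hc1 d)
    refine (mul_le_of_le_one_left (norm_nonneg _) h3).trans (h2.trans ?_)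
    have h4 : Real.log ((N / d : ℕ) : ℝ) ≤ Real.log N := by
      have h5 : 0 < N / d := Nat.div_pos (hd1.trans hU) hd0
      apply Real.log_le_log (by exact_mod_cast h5)
      exact_mod_cast Nat.div_le_self N d
    calc _ ≤ 2 * Real.log N * (g * cappedInv ((N : ℝ) / d) (α * ((A * g : ℕ) * d))) := by
          have := hnn d
          gcongr
      _ = _ := by ring
  · intro d hd hd2
    have hd0 := (Finset.mem_Ioc.1 hd).1
    have h0 : ¬ d ≤ U := fun h => hd2 (Finset.mem_Ioc.2 ⟨hd0, by nlinarith⟩)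
    simp [lowPart_apply, h0]

lemma norm_sum_lowPart_mul_zeta_le (hg : 1 ≤ g)
    (hc : ∀ m, c (m + g) = c m) (hc1 : ∀ m, ‖c m‖ ≤ 1) (hcm : ∀ m n, c (m * n) = c m * c n)
    (hU : U * U ≤ N) :
    ‖∑ n ∈ Finset.Ioc 0 N,
        ((lowPart U Λ * lowPart U (μ : ArithmeticFunction ℝ) * (ζ : ArithmeticFunction ℝ)) n : ℂ)
        * (c n * e (α * (A * (n : ℝ))))‖
      ≤ g * Real.log N *
        ∑ d ∈ Finset.Ioc 0 (U * U), cappedInv ((N : ℝ) / d) (α * ((A * g : ℕ) * d)) := by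
  have hnn : ∀ d : ℕ, 0 ≤ cappedInv ((N : ℝ) / d) (α * ((A * g : ℕ) * d)) :=
    fun d => cappedInv_nonneg (by positivity) _
  have hlogN : 0 ≤ Real.log N := Real.log_natCast_nonneg N
  set u := lowPart U Λ * lowPart U (μ : ArithmeticFunction ℝ) with hu
  rw [sum_Ioc_convolution_mul _ _ (fun n => c n * e (α * (A * (n : ℝ)))),
    ← Finset.sum_subset (Finset.Ioc_subset_Ioc_right hU), Finset.mul_sum]
  · refine norm_sum_le_of_le _ fun d hd => ?_
    have hd0 := (Finset.mem_Ioc.1 hd).1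
    have hd1 := (Finset.mem_Ioc.1 hd).2
    have h1 : ∑ m ∈ Finset.Ioc 0 (N / d), (u d : ℂ)
          * ((ζ : ArithmeticFunction ℝ) m : ℂ) * (c (d * m) * e (α * (A * ((d * m : ℕ) : ℝ))))
        = (u d : ℂ) * c d *
          ∑ m ∈ Finset.Ioc 0 (N / d), c m * e (α * (A * ((d * m : ℕ) : ℝ))) := by
      rw [Finset.mul_sum]
      refine Finset.sum_congr rfl fun m hm => ?_
      have hm0 := (Finset.mem_Ioc.1 hm).1.ne'
      rw [hcm, natCoe_apply, zeta_apply, if_neg hm0]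
      push_cast
      ring
    have h2 := norm_linear_sum_le hg hc hc1 α A (N := N) (le_refl (N / d))
    rw [h1, norm_mul, norm_mul, Complex.norm_real, Real.norm_eq_abs]
    have h3 : |u d| * ‖c d‖ ≤ Real.log N := by
      refine (mul_le_of_le_one_right (abs_nonneg _) (hc1 d)).trans ?_
      refine (abs_mul_le_log (abs_lowPart_vonMangoldt_le U) (abs_lowPart_moebius_le U) d).trans ?_
      apply Real.log_le_log (by exact_mod_cast hd0)
      exact_mod_cast hd1.trans hU
    calc _ ≤ Real.log N * (g * cappedInv ((N : ℝ) / d) (α * ((A * g : ℕ) * d))) := by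
          have := hnn d
          gcongr
      _ = _ := by ring
  · intro d hd hd2
    have hd0 := (Finset.mem_Ioc.1 hd).1
    have h0 : U * U < d := by
      by_contra h
      exact hd2 (Finset.mem_Ioc.2 ⟨hd0, by omega⟩)
    rw [hu, lowPart_mul_lowPart_eq_zero _ _ h0]
    simp

end pieces

lemma sum_Ico_two_pow (G : ℕ → ℂ) (I : ℕ) :
    ∑ b ∈ Finset.Ico 1 (2 ^ I), G b
      = ∑ i ∈ Finset.range I, ∑ b ∈ Finset.Ico (2 ^ i) (2 * 2 ^ i), G b := by
  induction I with
  | zero => simp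
  | succ I ih =>
    rw [Finset.sum_range_succ, ← ih, pow_succ, mul_comm (2 ^ I) 2,
      Finset.sum_Ico_consecutive _ Nat.one_le_two_pow (by omega)]

/-- The main factor of the bound. -/
noncomputable def mainTerm (x : ℝ) (q : ℕ) : ℝ :=
  x ^ ((4 : ℝ) / 5) + x * (q : ℝ) ^ (-(1 : ℝ) / 2) + x ^ ((1 : ℝ) / 2) * (q : ℝ) ^ ((1 : ℝ) / 2)

lemma natCast_log_gt {N : ℕ} (hN : 2 ≤ N) : 0.69 < Real.log N := by
  have h2 : (2 : ℝ) ≤ N := by exact_mod_cast hN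
  have := Real.log_le_log two_pos h2
  linarith [Real.log_two_gt_d9]

section mainTerm

variable {x : ℝ} {q : ℕ}

lemma mainTerm_mono {y : ℝ} (hx : 0 ≤ x) (hxy : x ≤ y) (q : ℕ) : mainTerm x q ≤ mainTerm y q := by
  unfold mainTerm
  gcongr

lemma mainTerm_nonneg (hx : 0 ≤ x) : 0 ≤ mainTerm x q := by
  unfold mainTerm
  positivity

lemma rpow_four_fifths_le_mainTerm (hx : 0 ≤ x) : x ^ ((4 : ℝ) / 5) ≤ mainTerm x q := by
  unfold mainTerm
  have : 0 ≤ x * (q : ℝ) ^ (-(1 : ℝ) / 2) := by positivity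
  have : 0 ≤ x ^ ((1 : ℝ) / 2) * (q : ℝ) ^ ((1 : ℝ) / 2) := by positivity
  linarith

lemma sq_add_sq_add_sq_le_mainTerm_sq (hx : 0 ≤ x) (hq : 1 ≤ q) :
    (x ^ ((4 : ℝ) / 5)) ^ 2 + x ^ 2 / q + x * q ≤ mainTerm x q ^ 2 := by
  have hq0 : (0 : ℝ) < q := by exact_mod_cast hq
  have h1 : x ^ 2 / q = (x * (q : ℝ) ^ (-(1 : ℝ) / 2)) ^ 2 := by
    rw [mul_pow, ← Real.rpow_mul_natCast hq0.le]
    norm_num [Real.rpow_neg_one, div_eq_mul_inv]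
  have h2 : x * q = (x ^ ((1 : ℝ) / 2) * (q : ℝ) ^ ((1 : ℝ) / 2)) ^ 2 := by
    rw [mul_pow, ← Real.rpow_mul_natCast hq0.le, ← Real.rpow_mul_natCast hx]
    norm_num
  rw [h1, h2]
  unfold mainTerm
  have p1 : 0 ≤ x ^ ((4 : ℝ) / 5) := by positivity
  have p2 : 0 ≤ x * (q : ℝ) ^ (-(1 : ℝ) / 2) := by positivity
  have p3 : 0 ≤ x ^ ((1 : ℝ) / 2) * (q : ℝ) ^ ((1 : ℝ) / 2) := by positivity
  nlinarith [mul_nonneg p1 p2, mul_nonneg p1 p3, mul_nonneg p2 p3]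

lemma le_mainTerm_of_sq_le_div (hx : 0 ≤ x) (hq : 1 ≤ q) {t : ℝ} (h : t ^ 2 ≤ x ^ 2 / q) :
    t ≤ mainTerm x q := by
  refine le_of_sq_le_sq ?_ (mainTerm_nonneg hx)
  have := sq_add_sq_add_sq_le_mainTerm_sq hx hq
  have : 0 ≤ x * q := by positivity
  nlinarith [sq_nonneg (x ^ ((4 : ℝ) / 5))]

lemma le_mainTerm_of_sq_le_mul (hx : 0 ≤ x) (hq : 1 ≤ q) {t : ℝ} (h : t ^ 2 ≤ x * q) :
    t ≤ mainTerm x q := by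
  refine le_of_sq_le_sq ?_ (mainTerm_nonneg hx)
  have := sq_add_sq_add_sq_le_mainTerm_sq hx hq
  have : 0 ≤ x ^ 2 / q := by positivity
  nlinarith [sq_nonneg (x ^ ((4 : ℝ) / 5))]

end mainTerm

section assembly

open ArithmeticFunction ArithmeticFunction.Moebius ArithmeticFunction.zeta

variable {A g N U q : ℕ} {c : ℕ → ℂ} {α : ℝ} {a : ℤ}

lemma bilinear_bound_le {N B q A ℓ L E : ℝ} (hN : 0 < N) (hB : 0 < B) (hq : 0 < q)
    (hA : 1 ≤ A) (hℓ : 1 / 2 ≤ ℓ) (hL : 0 ≤ L) (hLℓ : 1 + L ≤ 3 * ℓ)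
    (hE : N ^ 2 / q + N * (N / B) + N * B + N * q ≤ 3 * E ^ 2) :
    ℓ ^ 2 * N * ((A * N / (B * q) + 1) * (3 * B + 12 * q * (1 + L)))
      ≤ (15 * A * ℓ ^ 2 * E) ^ 2 := by
  have hℓ0 : 0 < ℓ := by linarith
  have hA0 : 0 < A := by linarith
  have hcoef : 108 ≤ 225 * ℓ * A :=
    calc (108 : ℝ) ≤ 225 * ℓ := by linarith
      _ ≤ 225 * ℓ * A := le_mul_of_one_le_right (by positivity) hA
  have hsum : 3 * B + 12 * q * (1 + L) ≤ 36 * ℓ * (B + q) := by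
    have h1 := mul_le_mul_of_nonneg_left hLℓ hq.le
    have h2 := mul_le_mul_of_nonneg_right hℓ hB.le
    linarith
  calc _ ≤ ℓ ^ 2 * N * ((A * N / (B * q) + A) * (36 * ℓ * (B + q))) := by gcongr
    _ = 36 * A * ℓ ^ 3 * (N ^ 2 / q + N * (N / B) + N * B + N * q) := by
        field_simp
        ring
    _ ≤ 36 * A * ℓ ^ 3 * (3 * E ^ 2) := by gcongr
    _ = A * ℓ ^ 3 * E ^ 2 * 108 := by ring
    _ ≤ A * ℓ ^ 3 * E ^ 2 * (225 * ℓ * A) := by gcongr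
    _ = _ := by ring

lemma norm_dyadic_block_le (hA : 0 < A) (hN : 2 ≤ N) (hq : 1 ≤ q) (hco : Int.gcd a q = 1)
    (hα : |α - (a : ℝ) / q| ≤ 1 / (q : ℝ) ^ 2) (hqN : q ≤ N)
    (hU : (N : ℝ) ^ ((2 : ℝ) / 5) ≤ U + 1) {γ β : ℕ → ℂ}
    (hγ : ∀ b, ‖γ b‖ ≤ 1) (hγ0 : ∀ b ≤ U, γ b = 0)
    (hβ : ∀ n, ‖β n‖ ≤ Real.log N) (hβ0 : ∀ n ≤ U, β n = 0) {B : ℕ} (hB : 0 < B) :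
    ‖∑ b ∈ Finset.Ico B (2 * B), ∑ n ∈ Finset.Ioc 0 (N / b),
        γ b * β n * e (α * (A * ((b * n : ℕ) : ℝ)))‖
      ≤ 15 * A * Real.log N ^ 2 * mainTerm N q := by
  have hN0 : (0 : ℝ) < N := by exact_mod_cast (by omega : 0 < N)
  have hB0 : (0 : ℝ) < B := by exact_mod_cast hB
  have hq0 : (0 : ℝ) < q := by exact_mod_cast hq
  have hA1 : (1 : ℝ) ≤ A := by exact_mod_cast hA
  have hE := mainTerm_nonneg (q := q) hN0.le
  have hℓ := natCast_log_gt hN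
  set ℓ := Real.log N with hℓdef
  have hRHS : 0 ≤ 15 * A * ℓ ^ 2 * mainTerm N q := by positivity
  by_cases hlow : 2 * B ≤ U + 1
  · rw [Finset.sum_eq_zero, norm_zero]
    · exact hRHS
    · intro b hb
      refine Finset.sum_eq_zero fun n _ => ?_
      rw [hγ0 b (by have := (Finset.mem_Ico.1 hb).2; omega)]
      simp
  by_cases hhigh : N < B * (U + 1)
  · rw [Finset.sum_eq_zero, norm_zero]
    · exact hRHS
    · intro b hb
      refine Finset.sum_eq_zero fun n hn => ?_
      have hBb := (Finset.mem_Ico.1 hb).1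
      have hn2 := (Finset.mem_Ioc.1 hn).2
      rw [Nat.le_div_iff_mul_le (by omega)] at hn2
      have : n ≤ U := by
        by_contra hcon
        have h1 : U + 1 ≤ n := by omega
        have := Nat.mul_le_mul h1 hBb
        rw [mul_comm] at this
        omega
      rw [hβ0 n this]
      simp
  have hu0 : (0 : ℝ) < (N : ℝ) ^ ((2 : ℝ) / 5) := by positivity
  set u : ℝ := (N : ℝ) ^ ((2 : ℝ) / 5) with hu
  have h2B : u ≤ 2 * B := by
    have : ((U + 1 : ℕ) : ℝ) ≤ ((2 * B : ℕ) : ℝ) := by exact_mod_cast (by omega)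
    push_cast at this
    linarith
  have hBu : B * u ≤ N := by
    have : ((B * (U + 1) : ℕ) : ℝ) ≤ N := by exact_mod_cast (by omega)
    push_cast at this
    exact (mul_le_mul_of_nonneg_left hU hB0.le).trans this
  have hP : ((N : ℝ) ^ ((4 : ℝ) / 5)) ^ 2 * u = (N : ℝ) ^ 2 := by
    rw [hu, ← Real.rpow_mul_natCast hN0.le, ← Real.rpow_add hN0]
    norm_num
  set P2 : ℝ := ((N : ℝ) ^ ((4 : ℝ) / 5)) ^ 2 with hP2
  have hNB : (N : ℝ) * B ≤ P2 := by
    have : (N : ℝ) * B * u ≤ P2 * u := by rw [hP]; nlinarith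
    exact le_of_mul_le_mul_right this hu0
  have hNdB : (N : ℝ) * (N / B) ≤ 2 * P2 := by
    rw [mul_div_assoc', div_le_iff₀ hB0, ← pow_two, ← hP]
    have : 0 ≤ P2 := by positivity
    nlinarith
  have hlogq : 1 + Real.log q ≤ 3 * ℓ := by
    have : Real.log q ≤ ℓ := Real.log_le_log hq0 (by exact_mod_cast hqN)
    linarith
  have hsq := bilinear_sq_le hq hco hα hA (N := N) hB hγ hβ
  have hE2 := sq_add_sq_add_sq_le_mainTerm_sq hN0.le hq
  refine le_of_sq_le_sq (hsq.trans (bilinear_bound_le hN0 hB0 hq0 hA1 (by linarith)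
    (Real.log_natCast_nonneg q) hlogq ?_)) hRHS
  have h3 : 0 ≤ (N : ℝ) * q := by positivity
  have h4 : 0 ≤ (N : ℝ) ^ 2 / q := by positivity
  linarith

lemma norm_sum_highPart_le (hA : 0 < A) (hN : 2 ≤ N) (hq : 1 ≤ q) (hco : Int.gcd a q = 1)
    (hα : |α - (a : ℝ) / q| ≤ 1 / (q : ℝ) ^ 2) (hqN : q ≤ N)
    (hU : (N : ℝ) ^ ((2 : ℝ) / 5) ≤ U + 1)
    (hc1 : ∀ m, ‖c m‖ ≤ 1) (hcm : ∀ m n, c (m * n) = c m * c n) :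
    ‖∑ n ∈ Finset.Ioc 0 N, ((highPart U (μ : ArithmeticFunction ℝ)
        * (highPart U Λ * (ζ : ArithmeticFunction ℝ))) n : ℂ) * (c n * e (α * (A * (n : ℝ))))‖
      ≤ 45 * A * Real.log N ^ 3 * mainTerm N q := by
  have hN0 : (0 : ℝ) < N := by exact_mod_cast (by omega : 0 < N)
  have hE := mainTerm_nonneg (q := q) hN0.le
  have hℓ := natCast_log_gt hN
  set u := highPart U Λ * (ζ : ArithmeticFunction ℝ) with hu
  set γ : ℕ → ℂ := fun b => (highPart U (μ : ArithmeticFunction ℝ) b : ℂ) * c b with hγdef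
  set β : ℕ → ℂ := fun n => if n ≤ N then (u n : ℂ) * c n else 0 with hβdef
  have hγ : ∀ b, ‖γ b‖ ≤ 1 := fun b => by
    rw [hγdef]
    simp only [norm_mul, Complex.norm_real, Real.norm_eq_abs]
    exact mul_le_one₀ (abs_highPart_moebius_le U b) (norm_nonneg _) (hc1 b)
  have hγ0 : ∀ b ≤ U, γ b = 0 := fun b hb => by simp [hγdef, highPart_apply, hb]
  have hβ0 : ∀ n ≤ U, β n = 0 := fun n hn => by
    have h0 : u n = 0 := highPart_mul_eq_zero _ _ hn
    simp [hβdef, h0]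
  have hβ : ∀ n, ‖β n‖ ≤ Real.log N := fun n => by
    rw [hβdef]
    simp only
    split_ifs with h
    · rw [norm_mul, Complex.norm_real, Real.norm_eq_abs]
      refine (mul_le_of_le_one_right (abs_nonneg _) (hc1 n)).trans ?_
      refine (abs_mul_le_log (abs_highPart_vonMangoldt_le U) (fun m => ?_) n).trans ?_
      · rw [natCoe_apply, zeta_apply]
        split_ifs <;> simp
      · rcases Nat.eq_zero_or_pos n with rfl | hn
        · simp only [Nat.cast_zero, Real.log_zero]
          linarith
        · exact Real.log_le_log (by exact_mod_cast hn) (by exact_mod_cast h)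
    · rw [norm_zero]; linarith
  set I := Nat.log 2 N + 1 with hI
  have hNI : N < 2 ^ I := Nat.lt_pow_succ_log_self one_lt_two N
  have hsum : ∑ n ∈ Finset.Ioc 0 N, ((highPart U (μ : ArithmeticFunction ℝ) * u) n : ℂ)
        * (c n * e (α * (A * (n : ℝ))))
      = ∑ i ∈ Finset.range I, ∑ b ∈ Finset.Ico (2 ^ i) (2 * 2 ^ i), ∑ n ∈ Finset.Ioc 0 (N / b),
          γ b * β n * e (α * (A * ((b * n : ℕ) : ℝ))) := by
    rw [sum_Ioc_convolution_mul _ _ (fun n => c n * e (α * (A * (n : ℝ)))), ← sum_Ico_two_pow]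
    rw [← Finset.sum_subset (s₁ := Finset.Ioc 0 N) (s₂ := Finset.Ico 1 (2 ^ I))]
    · refine Finset.sum_congr rfl fun b _ => Finset.sum_congr rfl fun n hn => ?_
      have hnN : n ≤ N := (Finset.mem_Ioc.1 hn).2.trans (Nat.div_le_self N b)
      simp only [hγdef, hβdef, if_pos hnN, hcm]
      ring
    · intro b hb
      have := Finset.mem_Ioc.1 hb
      exact Finset.mem_Ico.2 ⟨this.1, by omega⟩
    · intro b hb hb2
      have hb1 := (Finset.mem_Ico.1 hb).1
      have : N < b := by
        by_contra h
        exact hb2 (Finset.mem_Ioc.2 ⟨hb1, by omega⟩)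
      rw [Nat.div_eq_of_lt this]
      simp
  have hIle : (I : ℝ) ≤ 3 * Real.log N := by
    have h1 : (Nat.log 2 N : ℝ) * Real.log 2 ≤ Real.log N := by
      rw [← Real.log_pow]
      apply Real.log_le_log (by positivity)
      exact_mod_cast Nat.pow_log_le_self 2 (by omega)
    have h2 := Real.log_two_gt_d9
    have h3 : (0 : ℝ) ≤ Nat.log 2 N := Nat.cast_nonneg _
    rw [hI]
    push_cast
    nlinarith
  rw [hsum]
  calc _ ≤ ∑ i ∈ Finset.range I, 15 * A * Real.log N ^ 2 * mainTerm N q :=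
        norm_sum_le_of_le _ fun i _ => norm_dyadic_block_le hA hN hq hco hα hqN hU hγ hγ0 hβ hβ0
          (Nat.two_pow_pos i)
    _ = I * (15 * A * Real.log N ^ 2 * mainTerm N q) := by
        rw [Finset.sum_const, Finset.card_range, nsmul_eq_mul]
    _ ≤ 3 * Real.log N * (15 * A * Real.log N ^ 2 * mainTerm N q) := by
        gcongr
    _ = _ := by ring

/-- The constant in the estimate of the linear sums. -/
noncomputable def linearConst (B : ℕ) : ℝ := 6 * B * (3 + 2 * Real.log (2 * B)) + 39 * (B + 1)

lemma sum_cappedInv_le_mainTerm (hN : 2 ≤ N) (hq : 1 ≤ q) (hco : Int.gcd a q = 1)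
    (hα : |α - (a : ℝ) / q| ≤ 1 / (q : ℝ) ^ 2) (hqN : q ≤ N)
    (hU : (U : ℝ) ≤ (N : ℝ) ^ ((2 : ℝ) / 5)) (hUN : U * U ≤ N) {B : ℕ} (hB : 1 ≤ B) :
    ∑ d ∈ Finset.Ioc 0 (U * U), cappedInv ((N : ℝ) / d) (α * (B * d))
      ≤ linearConst B * Real.log N * mainTerm N q := by
  have hN0 : (0 : ℝ) < N := by exact_mod_cast (by omega : 0 < N)
  have hN1 : (1 : ℝ) ≤ N := by exact_mod_cast (by omega : 1 ≤ N)
  have hB1 : (1 : ℝ) ≤ B := by exact_mod_cast hB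
  have hq0 : (0 : ℝ) < q := by exact_mod_cast hq
  have hq1 : (1 : ℝ) ≤ q := by exact_mod_cast hq
  have hqN' : (q : ℝ) ≤ N := by exact_mod_cast hqN
  have hE := mainTerm_nonneg (q := q) hN0.le
  have hℓ := natCast_log_gt hN
  have h := sum_cappedInv_multiples_le hq hco hα hB hN0.le (U * U)
  have hlog1 : 1 + Real.log ((B * (U * U) : ℕ) + 1) ≤ (3 + 2 * Real.log (2 * B)) * Real.log N := by
    have h1 : ((B * (U * U) : ℕ) : ℝ) + 1 ≤ 2 * B * N := by
      have : ((U * U : ℕ) : ℝ) ≤ N := by exact_mod_cast hUN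
      push_cast at this ⊢
      nlinarith
    have h2 : Real.log ((B * (U * U) : ℕ) + 1) ≤ Real.log (2 * B) + Real.log N := by
      rw [← Real.log_mul (by positivity) (by positivity)]
      exact Real.log_le_log (by positivity) h1
    have h3 : 0 ≤ Real.log (2 * B) := Real.log_nonneg (by linarith)
    nlinarith
  have hlog2 : 6 + 12 * (1 + Real.log q) ≤ 39 * Real.log N := by
    have : Real.log q ≤ Real.log N := Real.log_le_log hq0 hqN'
    linarith
  have hNq : (N : ℝ) / q ≤ mainTerm N q := by
    refine le_mainTerm_of_sq_le_div hN0.le hq ?_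
    rw [div_pow]
    gcongr
    nlinarith
  have hqE : (q : ℝ) ≤ mainTerm N q := le_mainTerm_of_sq_le_mul hN0.le hq (by nlinarith)
  have hUE : ((U * U : ℕ) : ℝ) ≤ mainTerm N q := by
    refine le_trans ?_ (rpow_four_fifths_le_mainTerm hN0.le)
    have h1 : (N : ℝ) ^ ((4 : ℝ) / 5) = (N : ℝ) ^ ((2 : ℝ) / 5) * (N : ℝ) ^ ((2 : ℝ) / 5) := by
      rw [← Real.rpow_add hN0]; norm_num
    rw [h1]
    push_cast
    gcongr
  have hlog3 : 0 ≤ Real.log (2 * B) := Real.log_nonneg (by linarith)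
  calc _ ≤ _ := h
    _ ≤ 6 * (B * N) / q * ((3 + 2 * Real.log (2 * B)) * Real.log N)
        + (((B * (U * U) : ℕ) : ℝ) + q) * (39 * Real.log N) := by gcongr
    _ = (6 * B * (3 + 2 * Real.log (2 * B)) * ((N : ℝ) / q) + 39 * (B * ((U * U : ℕ) : ℝ) + q))
        * Real.log N := by push_cast; ring
    _ ≤ (6 * B * (3 + 2 * Real.log (2 * B)) * mainTerm N q
          + 39 * (B * mainTerm N q + mainTerm N q)) * Real.log N := by gcongr
    _ = _ := by unfold linearConst; ring

lemma norm_sum_vonMangoldt_le (hA : 0 < A) (hg : 1 ≤ g) (hN : 2 ≤ N) (hq : 1 ≤ q)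
    (hco : Int.gcd a q = 1) (hα : |α - (a : ℝ) / q| ≤ 1 / (q : ℝ) ^ 2) (hqN : q ≤ N)
    (hc : ∀ m, c (m + g) = c m) (hc1 : ∀ m, ‖c m‖ ≤ 1) (hcm : ∀ m n, c (m * n) = c m * c n) :
    ‖∑ n ∈ Finset.Ioc 0 N, (Λ n : ℂ) * (c n * e (α * (A * (n : ℝ))))‖
      ≤ (3 + 6 * g * linearConst (A * g) + 45 * A) * mainTerm N q * Real.log N ^ 3 := by
  have hN0 : (0 : ℝ) < N := by exact_mod_cast (by omega : 0 < N)
  have hN1 : (1 : ℝ) ≤ N := by exact_mod_cast (by omega : 1 ≤ N)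
  have hE := mainTerm_nonneg (q := q) hN0.le
  have hℓ := natCast_log_gt hN
  set U := ⌊(N : ℝ) ^ ((2 : ℝ) / 5)⌋₊ with hUdef
  have hUle : (U : ℝ) ≤ (N : ℝ) ^ ((2 : ℝ) / 5) := Nat.floor_le (by positivity)
  have hUlt : (N : ℝ) ^ ((2 : ℝ) / 5) ≤ U + 1 := (Nat.lt_floor_add_one _).le
  have hUUP : (U : ℝ) * U ≤ (N : ℝ) ^ ((4 : ℝ) / 5) := by
    have h1 : (N : ℝ) ^ ((4 : ℝ) / 5) = (N : ℝ) ^ ((2 : ℝ) / 5) * (N : ℝ) ^ ((2 : ℝ) / 5) := by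
      rw [← Real.rpow_add hN0]; norm_num
    rw [h1]
    gcongr
  have hUUN : U * U ≤ N := by
    have : (N : ℝ) ^ ((4 : ℝ) / 5) ≤ (N : ℝ) ^ (1 : ℝ) :=
      Real.rpow_le_rpow_of_exponent_le hN1 (by norm_num)
    rw [Real.rpow_one] at this
    exact_mod_cast hUUP.trans this
  have hUN : U ≤ N := (Nat.le_mul_self U).trans hUUN
  have hUE : (U : ℝ) ≤ mainTerm N q := by
    refine le_trans ?_ (hUUP.trans (rpow_four_fifths_le_mainTerm hN0.le))
    exact_mod_cast Nat.le_mul_self U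
  set f : ℕ → ℂ := fun n => c n * e (α * (A * (n : ℝ))) with hf
  have hB : 1 ≤ A * g := Nat.mul_pos hA hg
  have hT := sum_cappedInv_le_mainTerm hN hq hco hα hqN hUle hUUN hB
  have h1 := norm_sum_lowPart_le (A := A) (α := α) hc1 hUN
  have h2 := norm_sum_moebius_log_le (A := A) (α := α) hg hc hc1 hcm hUUN
  have h3 := norm_sum_lowPart_mul_zeta_le (A := A) (α := α) hg hc hc1 hcm hUUN
  have h4 := norm_sum_highPart_le hA hN hq hco hα hqN hUlt hc1 hcm
  set T := ∑ d ∈ Finset.Ioc 0 (U * U), cappedInv ((N : ℝ) / d) (α * ((A * g : ℕ) * d)) with hTdef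
  have hsplit : ∑ n ∈ Finset.Ioc 0 N, (Λ n : ℂ) * f n
      = ∑ n ∈ Finset.Ioc 0 N, (lowPart U Λ n : ℂ) * f n
        + ∑ n ∈ Finset.Ioc 0 N, ((lowPart U (μ : ArithmeticFunction ℝ) * log) n : ℂ) * f n
        - ∑ n ∈ Finset.Ioc 0 N, ((lowPart U Λ * lowPart U (μ : ArithmeticFunction ℝ)
            * (ζ : ArithmeticFunction ℝ)) n : ℂ) * f n
        + ∑ n ∈ Finset.Ioc 0 N, ((highPart U (μ : ArithmeticFunction ℝ)
            * (highPart U Λ * (ζ : ArithmeticFunction ℝ))) n : ℂ) * f n := by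
    rw [← Finset.sum_add_distrib, ← Finset.sum_sub_distrib, ← Finset.sum_add_distrib]
    refine Finset.sum_congr rfl fun n _ => ?_
    have := congrArg (fun F : ArithmeticFunction ℝ => F n) (vaughan_identity U)
    simp only [sub_eq_add_neg, ArithmeticFunction.add_apply, ArithmeticFunction.neg_apply] at this
    rw [this]
    push_cast
    ring
  have hlin : 0 ≤ linearConst (A * g) := by
    have : (1 : ℝ) ≤ (A * g : ℕ) := by exact_mod_cast hB
    have : 0 ≤ Real.log (2 * (A * g : ℕ)) := Real.log_nonneg (by linarith)
    unfold linearConst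
    positivity
  set ℓ := Real.log N with hℓdef
  set K := linearConst (A * g) with hK
  set E := mainTerm N q with hEdef
  rw [hsplit]
  calc _ ≤ U * ℓ + 2 * g * ℓ * T + g * ℓ * T + 45 * A * ℓ ^ 3 * E := by
        refine (norm_add_le _ _).trans (add_le_add ?_ h4)
        refine (norm_sub_le _ _).trans (add_le_add ?_ h3)
        exact (norm_add_le _ _).trans (add_le_add h1 h2)
    _ = U * ℓ + 3 * g * ℓ * T + 45 * A * ℓ ^ 3 * E := by ring
    _ ≤ E * ℓ + 3 * g * ℓ * (K * ℓ * E) + 45 * A * ℓ ^ 3 * E := by gcongr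
    _ = E * ℓ * 1 + (3 * g * K * E * ℓ ^ 2) * 1 + 45 * A * ℓ ^ 3 * E := by ring
    _ ≤ E * ℓ * (3 * ℓ ^ 2) + (3 * g * K * E * ℓ ^ 2) * (2 * ℓ) + 45 * A * ℓ ^ 3 * E := by
        gcongr
        · nlinarith
        · linarith
    _ = _ := by ring

lemma norm_sum_prime_le (hA : 0 < A) (hg : 1 ≤ g) (hN : 2 ≤ N) (hq : 1 ≤ q)
    (hco : Int.gcd a q = 1) (hα : |α - (a : ℝ) / q| ≤ 1 / (q : ℝ) ^ 2)
    (hc : ∀ m, c (m + g) = c m) (hc1 : ∀ m, ‖c m‖ ≤ 1) (hcm : ∀ m n, c (m * n) = c m * c n) :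
    ‖∑ p ∈ (Finset.Ioc 0 N).filter (fun p : ℕ => p.Prime),
        (Real.log p : ℂ) * (c p * e (α * (A * (p : ℝ))))‖
      ≤ (9 + 6 * g * linearConst (A * g) + 45 * A) * mainTerm N q * Real.log N ^ 3 := by
  have hN0 : (0 : ℝ) < N := by exact_mod_cast (by omega : 0 < N)
  have hN1 : (1 : ℝ) ≤ N := by exact_mod_cast (by omega : 1 ≤ N)
  have hq1 : (1 : ℝ) ≤ q := by exact_mod_cast hq
  have hE := mainTerm_nonneg (q := q) hN0.le
  have hℓ := natCast_log_gt hN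
  have hlin : 0 ≤ linearConst (A * g) := by
    have : (1 : ℝ) ≤ (A * g : ℕ) := by exact_mod_cast Nat.mul_pos hA hg
    have : 0 ≤ Real.log (2 * (A * g : ℕ)) := Real.log_nonneg (by linarith)
    unfold linearConst
    positivity
  set f : ℕ → ℂ := fun n => c n * e (α * (A * (n : ℝ))) with hf
  have hf1 : ∀ n, ‖f n‖ ≤ 1 := fun n => by
    simp only [hf, norm_mul, norm_e, mul_one]
    exact hc1 n
  have hℓ3 : Real.log N ≤ 3 * Real.log N ^ 3 := by
    have : 1 ≤ 3 * Real.log N ^ 2 := by nlinarith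
    nlinarith
  rcases le_or_gt q N with hqN | hqN
  · have hmain := norm_sum_vonMangoldt_le hA hg hN hq hco hα hqN hc hc1 hcm
    have hsplit : ∑ p ∈ (Finset.Ioc 0 N).filter (fun p : ℕ => p.Prime), (Real.log p : ℂ) * f p
        = ∑ n ∈ Finset.Ioc 0 N, (Λ n : ℂ) * f n
          - ∑ n ∈ (Finset.Ioc 0 N).filter (fun p : ℕ => ¬ p.Prime), (Λ n : ℂ) * f n := by
      rw [← Finset.sum_filter_add_sum_filter_not (Finset.Ioc 0 N) (fun p : ℕ => p.Prime)
        (fun n => (Λ n : ℂ) * f n), add_sub_cancel_right]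
      refine Finset.sum_congr rfl fun p hp => ?_
      rw [vonMangoldt_apply_prime (Finset.mem_filter.1 hp).2]
    have hpow : ‖∑ n ∈ (Finset.Ioc 0 N).filter (fun p : ℕ => ¬ p.Prime), (Λ n : ℂ) * f n‖
        ≤ 2 * mainTerm N q * Real.log N := by
      have h1 := Chebyshev.psi_sub_theta_le hN1
      rw [Chebyshev.psi_sub_theta_eq_sum_not_prime, Nat.floor_natCast] at h1
      have h2 : √(N : ℝ) ≤ mainTerm N q := by
        refine le_mainTerm_of_sq_le_mul hN0.le hq ?_
        rw [Real.sq_sqrt hN0.le]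
        nlinarith
      calc _ ≤ ∑ n ∈ (Finset.Ioc 0 N).filter (fun p : ℕ => ¬ p.Prime), Λ n := by
            refine norm_sum_le_of_le _ fun n _ => ?_
            rw [norm_mul, Complex.norm_real, Real.norm_of_nonneg vonMangoldt_nonneg]
            exact mul_le_of_le_one_right vonMangoldt_nonneg (hf1 n)
        _ ≤ 2 * √(N : ℝ) * Real.log N := by
            refine le_trans (le_of_eq ?_) h1
            exact Finset.sum_congr (by ext; simp) fun _ _ => rfl
        _ ≤ _ := by gcongr
    rw [hsplit]
    refine (norm_sub_le _ _).trans ((add_le_add hmain hpow).trans ?_)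
    nlinarith [mul_le_mul_of_nonneg_left hℓ3 hE]
  · have hNE : (N : ℝ) ≤ mainTerm N q := by
      refine le_mainTerm_of_sq_le_mul hN0.le hq ?_
      have : (N : ℝ) ≤ q := by exact_mod_cast hqN.le
      nlinarith
    calc _ ≤ ∑ p ∈ (Finset.Ioc 0 N).filter (fun p : ℕ => p.Prime), Real.log N := by
          refine norm_sum_le_of_le _ fun p hp => ?_
          have hp' := Finset.mem_Ioc.1 (Finset.mem_filter.1 hp).1
          rw [norm_mul, Complex.norm_real, Real.norm_of_nonneg (Real.log_natCast_nonneg p)]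
          refine (mul_le_of_le_one_right (Real.log_natCast_nonneg p) (hf1 p)).trans ?_
          exact Real.log_le_log (by exact_mod_cast hp'.1) (by exact_mod_cast hp'.2)
      _ ≤ N * Real.log N := by
          rw [Finset.sum_const, nsmul_eq_mul]
          gcongr
          refine (Finset.card_filter_le _ _).trans ?_
          simp
      _ ≤ mainTerm N q * (3 * Real.log N ^ 3) := by gcongr
      _ = 3 * mainTerm N q * Real.log N ^ 3 := by ring
      _ ≤ _ := by
          gcongr
          have : 0 ≤ 6 * g * linearConst (A * g) := by positivity
          have : (0 : ℝ) ≤ 45 * A := by positivity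
          linarith

end assembly

/-- Minor-arc bound for the character-twisted exponential sum over primes:
if `|α - a/q| ≤ 1/q²` with `gcd(a,q)=1`, then
`|∑_{p ≤ x} χ(p)(log p) e(αAp)| ≤ C (x^{4/5} + x q^{-1/2} + x^{1/2} q^{1/2}) (log x)³`. -/
theorem prime_exponential_sum_character_bound
    (A g : ℕ) (hA : 0 < A) (hg : 0 < g) :
    ∃ C : ℝ, ∀ (χ : DirichletCharacter ℂ g),
      ∀ (α : ℝ) (a : ℤ) (q : ℕ), 1 ≤ q → Int.gcd a q = 1 →
        |α - (a : ℝ) / q| ≤ 1 / (q : ℝ) ^ 2 →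
        ∀ x : ℝ, 2 ≤ x →
          ‖∑ p ∈ (Finset.Icc 1 ⌊x⌋₊).filter (fun p : ℕ => p.Prime),
              χ (p : ZMod g) * (Real.log p : ℂ) * e (α * (A * p))‖
            ≤ C * (x ^ ((4 : ℝ) / 5) + x * (q : ℝ) ^ (-(1 : ℝ) / 2)
                + x ^ ((1 : ℝ) / 2) * (q : ℝ) ^ ((1 : ℝ) / 2)) * Real.log x ^ 3 := by
  refine ⟨9 + 6 * g * linearConst (A * g) + 45 * A, fun χ α a q hq hco hα x hx => ?_⟩
  have hN : 2 ≤ ⌊x⌋₊ := Nat.le_floor (by exact_mod_cast hx)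
  have hNx : (⌊x⌋₊ : ℝ) ≤ x := Nat.floor_le (by linarith)
  set N := ⌊x⌋₊ with hNdef
  have hN0 : (0 : ℝ) < N := by exact_mod_cast (by omega : 0 < N)
  have hE := mainTerm_nonneg (q := q) hN0.le
  have hℓ := natCast_log_gt hN
  have hlin : 0 ≤ linearConst (A * g) := by
    have : (1 : ℝ) ≤ (A * g : ℕ) := by exact_mod_cast Nat.mul_pos hA hg
    have : 0 ≤ Real.log (2 * (A * g : ℕ)) := Real.log_nonneg (by linarith)
    unfold linearConst
    positivity
  have h := norm_sum_prime_le (c := fun n => χ (n : ZMod g)) hA hg hN hq hco hα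
    (fun m => by simp) (fun m => χ.norm_le_one _) (fun m n => by simp)
  calc _ = ‖∑ p ∈ (Finset.Ioc 0 N).filter (fun p : ℕ => p.Prime),
        (Real.log p : ℂ) * (χ (p : ZMod g) * e (α * (A * (p : ℝ))))‖ := by
        congr 1
        refine Finset.sum_congr ?_ fun p _ => by ring
        ext p
        simp [Nat.succ_le_iff]
    _ ≤ _ := h
    _ ≤ (9 + 6 * g * linearConst (A * g) + 45 * A) * mainTerm x q * Real.log x ^ 3 := by
        have hEx := mainTerm_mono hN0.le hNx q
        have hEx0 := hE.trans hEx
        gcongr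
    _ = _ := rfl
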